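/- The Diophantine equation 5^x − 1 = L_r in nonnegative integers r, x has only the solution (r, x) = (3, 1). -/

import Mathlib

/-- The Lucas sequence: `L 0 = 2`, `L 1 = 1`, `L (n+2) = L (n+1) + L n`. -/
def lucas : ℕ → ℕ
  | 0 => 2
  | 1 => 1
  | n + 2 => lucas (n + 1) + lucas n

theorem lucas_add_two (n : ℕ) : lucas (n + 2) = lucas (n + 1) + lucas n := rfl

theorem lucas_add_four (n : ℕ) : lucas (n + 4) = 3 * lucas (n + 1) + 2 * lucas n := by
  have h₂ := lucas_add_two n
  have h₃ : lucas (n + 3) = lucas (n + 2) + lucas (n + 1) := lucas_add_two (n + 1)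
  have h₄ : lucas (n + 4) = lucas (n + 3) + lucas (n + 2) := lucas_add_two (n + 2)
  omega

theorem lucas_add_four_mod_five (n : ℕ) : lucas (n + 4) % 5 = lucas n % 5 := by
  induction n using Nat.twoStepInduction with
  | zero => rfl
  | one => rfl
  | more n h₀ h₁ =>
    have h := lucas_add_two n
    have h' := lucas_add_two (n + 4)
    rw [show n + 2 + 4 = n + 4 + 2 by omega, h', h, show n + 4 + 1 = n + 1 + 4 by omega]
    omega

theorem mod_four_eq_three_of_lucas_mod_five :
    ∀ n : ℕ, lucas n % 5 = 4 → n % 4 = 3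
  | 0, h | 1, h | 2, h => by simp [lucas] at h
  | 3, _ => rfl
  | n + 4, h => by
    rw [lucas_add_four_mod_five] at h
    have := mod_four_eq_three_of_lucas_mod_five n h
    omega

theorem lucas_pos : ∀ n : ℕ, 0 < lucas n
  | 0 | 1 => by simp [lucas]
  | n + 2 => Nat.add_pos_right _ (lucas_pos n)

/-- The factorization of `lucas (4 * k + 3) + 1`, together with the formula for the next Lucas
number and Cassini's identity, which make the induction work. -/
theorem lucas_four_mul_add_three_aux (k : ℕ) :
    (lucas (4 * k + 3) : ℤ) + 1 = 5 * Nat.fib (2 * k + 1) * Nat.fib (2 * k + 2) ∧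
    (lucas (4 * k + 4) : ℤ) + 2 = (2 * Nat.fib (2 * k + 1) + Nat.fib (2 * k + 2)) ^ 2 ∧
    (Nat.fib (2 * k + 1) : ℤ) ^ 2 + Nat.fib (2 * k + 1) * Nat.fib (2 * k + 2) -
      (Nat.fib (2 * k + 2) : ℤ) ^ 2 = 1 := by
  induction k with
  | zero => simp [lucas]
  | succ k ih =>
    obtain ⟨h₃, h₄, hc⟩ := ih
    have l₅ : lucas (4 * k + 5) = lucas (4 * k + 4) + lucas (4 * k + 3) := rfl
    have l₇ : lucas (4 * (k + 1) + 3) = 3 * lucas (4 * k + 4) + 2 * lucas (4 * k + 3) :=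
      lucas_add_four (4 * k + 3)
    have l₈ : lucas (4 * (k + 1) + 4) = 3 * lucas (4 * k + 5) + 2 * lucas (4 * k + 4) :=
      lucas_add_four (4 * k + 4)
    have f₃ : Nat.fib (2 * (k + 1) + 1) = Nat.fib (2 * k + 1) + Nat.fib (2 * k + 2) :=
      Nat.fib_add_two
    have f₄ : Nat.fib (2 * (k + 1) + 2) = Nat.fib (2 * k + 2) + Nat.fib (2 * (k + 1) + 1) :=
      Nat.fib_add_two
    rw [l₈, l₇, l₅, f₄, f₃]
    push_cast
    generalize (Nat.fib (2 * k + 1) : ℤ) = a at *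
    generalize (Nat.fib (2 * k + 2) : ℤ) = b at *
    refine ⟨?_, ?_, ?_⟩
    · linear_combination 2 * h₃ + 3 * h₄ + 7 * hc
    · linear_combination 3 * h₃ + 5 * h₄ + 11 * hc
    · linear_combination hc

theorem lucas_four_mul_add_three (k : ℕ) :
    lucas (4 * k + 3) + 1 = 5 * (Nat.fib (2 * k + 1) * Nat.fib (2 * k + 2)) := by
  have h := (lucas_four_mul_add_three_aux k).1
  rw [mul_assoc] at h
  exact_mod_cast h

theorem eq_one_or_eq_one_of_coprime_of_mul_eq_prime_pow {p a b n : ℕ} (hp : p.Prime)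
    (hab : a.Coprime b) (h : a * b = p ^ n) : a = 1 ∨ b = 1 := by
  obtain ⟨i, -, rfl⟩ := (Nat.dvd_prime_pow hp).1 (Dvd.intro b h)
  obtain ⟨j, -, rfl⟩ := (Nat.dvd_prime_pow hp).1 (Dvd.intro_left _ h)
  rcases i.eq_zero_or_pos with rfl | hi
  · simp
  rcases j.eq_zero_or_pos with rfl | hj
  · simp
  rw [Nat.coprime_pow_left_iff hi, Nat.coprime_pow_right_iff hj, Nat.coprime_self] at hab
  exact absurd hab hp.ne_one

theorem five_pow_sub_one_eq_lucas (r x : ℕ) :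
    (5 : ℤ) ^ x - 1 = lucas r ↔ (r, x) = (3, 1) := by
  rw [Prod.mk.injEq]
  refine ⟨fun h => ?_, by rintro ⟨rfl, rfl⟩; simp [lucas]⟩
  have h : lucas r + 1 = 5 ^ x := by
    zify
    linarith
  cases x with
  | zero =>
    have := lucas_pos r
    simp at h
    omega
  | succ y =>
    rw [pow_succ'] at h
    have hr := mod_four_eq_three_of_lucas_mod_five r (by omega)
    obtain ⟨k, rfl⟩ : ∃ k, r = 4 * k + 3 := ⟨r / 4, by omega⟩
    rw [lucas_four_mul_add_three] at h
    have hmul : Nat.fib (2 * k + 1) * Nat.fib (2 * k + 2) = 5 ^ y := by omega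
    rcases k.eq_zero_or_pos with rfl | hk
    · have : 5 ^ y = 1 := by simpa using hmul.symm
      simpa using this
    · have h₁ : Nat.fib 3 ≤ Nat.fib (2 * k + 1) := Nat.fib_mono (by omega)
      have h₂ : Nat.fib 3 ≤ Nat.fib (2 * k + 2) := Nat.fib_mono (by omega)
      have h₃ : Nat.fib 3 = 2 := rfl
      have hcop : (Nat.fib (2 * k + 1)).Coprime (Nat.fib (2 * k + 2)) :=
        Nat.fib_coprime_fib_succ (2 * k + 1)
      rcases eq_one_or_eq_one_of_coprime_of_mul_eq_prime_pow Nat.prime_five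
        hcop hmul with h | h <;> omega
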